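/- arXiv:1712.08380 — 3 statements merged into one kernel-verified Lean document; each statement's English description precedes it below -/
import Mathlib

section
/- For every r > 0, every a ∈ ℝ², every α ∈ ℝ, and every smooth function u : ℝ² → ℂ whose support is compact and contained in D_r(a) \ {a}, one has ∫_{D_r(a)} ‖i∇u(x) + A_a^α(x)·u(x)‖² dx ≥ (min_{j∈ℤ} |j − α|)² · ∫_{D_r(a)} |u(x)|² / ‖x − a‖² dx, where i∇u + A_a^α u denotes the ℂ²-valued function whose k-th component is i·∂_k u + (A_a^α)_k·u. -/
open MeasureTheory Complex

lemma hti_iInf_sq_le (α : ℝ) (n : ℤ) :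
    (⨅ j : ℤ, |(j : ℝ) - α|) ^ 2 ≤ ((n : ℝ) - α) ^ 2 := by
  have hbdd : BddBelow (Set.range fun j : ℤ => |(j : ℝ) - α|) :=
    ⟨0, by rintro _ ⟨j, rfl⟩; exact abs_nonneg _⟩
  have h0 : 0 ≤ ⨅ j : ℤ, |(j : ℝ) - α| := Real.iInf_nonneg fun j => abs_nonneg _
  have h1 := ciInf_le hbdd n
  rw [← sq_abs ((n : ℝ) - α)]
  exact pow_le_pow_left₀ h0 h1 2

/-- Fourier coefficients of the derivative of a periodic function. -/
lemma hti_coeff_deriv (v v' : ℝ → ℂ) (hv : ∀ t, HasDerivAt v (v' t) t) (hc : Continuous v')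
    (hper : v Real.pi = v (-Real.pi)) (hab : -Real.pi < Real.pi) (n : ℤ) :
    fourierCoeffOn hab v' n = I * n * fourierCoeffOn hab v n := by
  rcases eq_or_ne n 0 with rfl | hn
  · rw [fourierCoeffOn_eq_integral]
    have : ∫ x in (-Real.pi)..Real.pi, v' x = 0 := by
      rw [intervalIntegral.integral_eq_sub_of_hasDerivAt (fun x _ => hv x)
        (hc.intervalIntegrable _ _), hper, sub_self]
    simp [this]
  · have h := fourierCoeffOn_of_hasDerivAt hab hn (fun x _ => hv x) (hc.intervalIntegrable _ _)
    have hpi : (Real.pi : ℂ) ≠ 0 := by exact_mod_cast Real.pi_ne_zero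
    have hn' : (n : ℂ) ≠ 0 := by exact_mod_cast hn
    rw [h, hper, sub_self]
    push_cast
    field_simp
    ring

/-- One-dimensional inequality on the circle. -/
lemma hti_circle (α : ℝ) (v v' : ℝ → ℂ) (hv : ∀ t, HasDerivAt v (v' t) t) (hc : Continuous v')
    (hper : v Real.pi = v (-Real.pi)) :
    (⨅ j : ℤ, |(j : ℝ) - α|) ^ 2 * ∫ t in (-Real.pi)..Real.pi, ‖v t‖ ^ 2 ≤
      ∫ t in (-Real.pi)..Real.pi, ‖I * v' t + α * v t‖ ^ 2 := by
  have hab : -Real.pi < Real.pi := by linarith [Real.pi_pos]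
  have hvc : Continuous v := continuous_iff_continuousAt.2 fun t => (hv t).continuousAt
  have hwc : Continuous (fun t => I * v' t + α * v t) := by fun_prop
  have hL : ∀ f : ℝ → ℂ, Continuous f →
      MemLp f 2 (volume.restrict (Set.Ioc (-Real.pi) Real.pi)) := by
    intro f hf
    rw [memLp_two_iff_integrable_sq_norm hf.aestronglyMeasurable]
    exact ((hf.norm.pow 2).integrableOn_Icc).mono_set Set.Ioc_subset_Icc_self
  have hcoef : ∀ n : ℤ, fourierCoeffOn hab (fun t => I * v' t + α * v t) n =
      ((α - n : ℝ) : ℂ) * fourierCoeffOn hab v n := by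
    intro n
    have hd := hti_coeff_deriv v v' hv hc hper hab n
    have hadd : fourierCoeffOn hab (fun t => I * v' t + α * v t) n =
        I * fourierCoeffOn hab v' n + α * fourierCoeffOn hab v n := by
      rw [← fourierCoeffOn.const_mul, ← fourierCoeffOn.const_mul]
      simp only [fourierCoeffOn_eq_integral]
      rw [← smul_add, ← intervalIntegral.integral_add]
      · simp only [smul_eq_mul, mul_add]
      · apply Continuous.intervalIntegrable
        exact ((fourier (-n)).continuous.comp (AddCircle.continuous_mk' _)).smul (by fun_prop)
      · apply Continuous.intervalIntegrable
        exact ((fourier (-n)).continuous.comp (AddCircle.continuous_mk' _)).smul (by fun_prop)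
    rw [hadd, hd]
    push_cast
    linear_combination (n * fourierCoeffOn hab v n) * I_mul_I
  have h1 := (hasSum_sq_fourierCoeffOn hab (hL v hvc)).mul_left ((⨅ j : ℤ, |(j : ℝ) - α|) ^ 2)
  have h2 := hasSum_sq_fourierCoeffOn hab (hL _ hwc)
  have h3 := hasSum_le (fun n => ?_) h1 h2
  · simp only [smul_eq_mul] at h3
    have hpos : 0 < (Real.pi - -Real.pi)⁻¹ := inv_pos.2 (by linarith)
    rw [mul_left_comm] at h3
    exact le_of_mul_le_mul_left h3 hpos
  · rw [hcoef n, norm_mul, mul_pow, Complex.norm_real, Real.norm_eq_abs, sq_abs]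
    apply mul_le_mul_of_nonneg_right _ (by positivity)
    have := hti_iInf_sq_le α n
    nlinarith

lemma hti_rot (P Q : ℂ) (c s : ℝ) (h : c ^ 2 + s ^ 2 = 1) :
    ‖-(s : ℂ) * P + c * Q‖ ^ 2 ≤ ‖P‖ ^ 2 + ‖Q‖ ^ 2 := by
  have h1 : ‖P‖ ^ 2 + ‖Q‖ ^ 2 = ‖-(s : ℂ) * P + c * Q‖ ^ 2 + ‖(c : ℂ) * P + s * Q‖ ^ 2 := by
    simp only [← Complex.normSq_eq_norm_sq, Complex.normSq_apply, add_re, add_im, mul_re, mul_im,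
      neg_re, neg_im, ofReal_re, ofReal_im]
    linear_combination (-(P.re ^ 2 + P.im ^ 2 + Q.re ^ 2 + Q.im ^ 2)) * h
  have := sq_nonneg ‖(c : ℂ) * P + s * Q‖
  linarith

/-- The integrated inequality on a circle of radius `ρ`. -/
lemma hti_radius (a : ℂ) (α : ℝ) (u : ℂ → ℂ)
    (hu : ContDiff ℝ (⊤ : ℕ∞) u) (F : ℂ → ℝ)
    (hF : F = fun x => (‖Complex.I * fderiv ℝ u x 1 +
            ((α * (-(x - a).im / ‖x - a‖ ^ 2) : ℝ) : ℂ) * u x‖ ^ 2 +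
         ‖Complex.I * fderiv ℝ u x Complex.I +
            ((α * ((x - a).re / ‖x - a‖ ^ 2) : ℝ) : ℂ) * u x‖ ^ 2))
    (hFc : Continuous F) (ρ : ℝ) (hρ : 0 < ρ) :
    0 ≤ ∫ t in Set.Ioo (-Real.pi) Real.pi,
      (F (ρ * (Real.cos t + Real.sin t * I) + a) - (⨅ j : ℤ, |(j : ℝ) - α|) ^ 2 *
        (‖u (ρ * (Real.cos t + Real.sin t * I) + a)‖ ^ 2 /
          ‖(ρ * (Real.cos t + Real.sin t * I) + a) - a‖ ^ 2)) := by
  set m := (⨅ j : ℤ, |(j : ℝ) - α|) ^ 2 with hm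
  set γ : ℝ → ℂ := fun t => ρ * (Real.cos t + Real.sin t * I) + a with hγ
  set γ' : ℝ → ℂ := fun t => ρ * (-Real.sin t + Real.cos t * I) with hγ'
  have hγd : ∀ t, HasDerivAt γ (γ' t) t := by
    intro t
    have h1 := (Real.hasDerivAt_cos t).ofReal_comp
    have h2 := ((Real.hasDerivAt_sin t).ofReal_comp).mul_const I
    have h3 := ((h1.add h2).const_mul (ρ : ℂ)).add_const a
    simp only [ofReal_neg] at h3
    exact h3
  have hγc : Continuous γ := continuous_iff_continuousAt.2 fun t => (hγd t).continuousAt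
  have hγc' : Continuous γ' := by
    simp only [hγ']; fun_prop
  have hdu : Continuous (fderiv ℝ u) := hu.continuous_fderiv (by simp)
  have hvd : ∀ t, HasDerivAt (fun t => u (γ t)) (fderiv ℝ u (γ t) (γ' t)) t := fun t =>
    ((hu.differentiable (by simp)).differentiableAt.hasFDerivAt).comp_hasDerivAt t (hγd t)
  have hvc' : Continuous fun t => fderiv ℝ u (γ t) (γ' t) :=
    (hdu.comp hγc).clm_apply hγc'
  have hvc : Continuous fun t => u (γ t) := hu.continuous.comp hγc
  have hcirc := hti_circle α _ _ hvd hvc' (by simp [hγ])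
  have hnorm : ∀ t, ‖γ t - a‖ ^ 2 = ρ ^ 2 := by
    intro t
    simp only [hγ, ← Complex.normSq_eq_norm_sq, Complex.normSq_apply]
    simp [-ofReal_cos, -ofReal_sin]
    linear_combination ρ ^ 2 * Real.sin_sq_add_cos_sq t
  have hpt : ∀ t, (ρ ^ 2)⁻¹ * (‖I * fderiv ℝ u (γ t) (γ' t) + α * u (γ t)‖ ^ 2
      - m * ‖u (γ t)‖ ^ 2) ≤ F (γ t) - m * (‖u (γ t)‖ ^ 2 / ‖γ t - a‖ ^ 2) := by
    intro t
    rw [hF]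
    simp only [hnorm]
    have hre : (γ t - a).re = ρ * Real.cos t := by simp [hγ, -ofReal_cos, -ofReal_sin]
    have him : (γ t - a).im = ρ * Real.sin t := by simp [hγ, -ofReal_cos, -ofReal_sin]
    rw [hre, him]
    set P := Complex.I * fderiv ℝ u (γ t) 1 +
            ((α * (-(ρ * Real.sin t) / ρ ^ 2) : ℝ) : ℂ) * u (γ t) with hP
    set Q := Complex.I * fderiv ℝ u (γ t) I +
            ((α * ((ρ * Real.cos t) / ρ ^ 2) : ℝ) : ℂ) * u (γ t) with hQ
    have hrot := hti_rot P Q (Real.cos t) (Real.sin t) (Real.cos_sq_add_sin_sq t)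
    have hlin : fderiv ℝ u (γ t) (γ' t) =
        ρ * (-Real.sin t * fderiv ℝ u (γ t) 1 + Real.cos t * fderiv ℝ u (γ t) I) := by
      have : γ' t = (ρ * -Real.sin t) • (1 : ℂ) + (ρ * Real.cos t) • I := by
        simp only [hγ', real_smul]; push_cast; ring
      rw [this, map_add, map_smul, map_smul, real_smul, real_smul]
      push_cast; ring
    have hkey : I * fderiv ℝ u (γ t) (γ' t) + α * u (γ t) =
        ρ * (-(Real.sin t : ℂ) * P + Real.cos t * Q) := by
      have hρ' : (ρ : ℂ) ≠ 0 := by exact_mod_cast hρ.ne'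
      have hcs : (Real.sin t : ℂ) ^ 2 + (Real.cos t : ℂ) ^ 2 = 1 := by
        exact_mod_cast Real.sin_sq_add_cos_sq t
      rw [hlin, hP, hQ]
      generalize fderiv ℝ u (γ t) 1 = d1
      generalize fderiv ℝ u (γ t) I = d2
      generalize u (γ t) = w
      push_cast [-ofReal_cos, -ofReal_sin]
      field_simp
      linear_combination (-(α * w)) * hcs
    have hρn : ‖(ρ : ℂ)‖ ^ 2 = ρ ^ 2 := by
      rw [Complex.norm_real, Real.norm_eq_abs, sq_abs]
    rw [hkey, norm_mul, mul_pow, hρn]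
    have hρ2 : (ρ ^ 2)⁻¹ * ρ ^ 2 = 1 := inv_mul_cancel₀ (by positivity)
    have e : (ρ ^ 2)⁻¹ * (ρ ^ 2 * ‖-(Real.sin t : ℂ) * P + Real.cos t * Q‖ ^ 2
        - m * ‖u (γ t)‖ ^ 2) = ‖-(Real.sin t : ℂ) * P + Real.cos t * Q‖ ^ 2
        - m * (‖u (γ t)‖ ^ 2 / ρ ^ 2) := by
      rw [div_eq_mul_inv]
      linear_combination (‖-(Real.sin t : ℂ) * P + Real.cos t * Q‖ ^ 2) * hρ2
    rw [e]
    linarith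
  have hab : -Real.pi ≤ Real.pi := by linarith [Real.pi_pos]
  rw [← integral_Ioc_eq_integral_Ioo, ← intervalIntegral.integral_of_le hab]
  have hwc : Continuous fun t => ‖I * fderiv ℝ u (γ t) (γ' t) + α * u (γ t)‖ ^ 2 := by fun_prop
  calc (0 : ℝ) ≤ (ρ ^ 2)⁻¹ * ((∫ t in (-Real.pi)..Real.pi,
          ‖I * fderiv ℝ u (γ t) (γ' t) + α * u (γ t)‖ ^ 2)
          - m * ∫ t in (-Real.pi)..Real.pi, ‖u (γ t)‖ ^ 2) := by
        apply mul_nonneg (by positivity); linarith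
    _ = ∫ t in (-Real.pi)..Real.pi, (ρ ^ 2)⁻¹ *
          (‖I * fderiv ℝ u (γ t) (γ' t) + α * u (γ t)‖ ^ 2 - m * ‖u (γ t)‖ ^ 2) := by
        rw [intervalIntegral.integral_const_mul, intervalIntegral.integral_sub,
          intervalIntegral.integral_const_mul]
        · exact hwc.intervalIntegrable _ _
        · exact (continuous_const.mul (hvc.norm.pow 2)).intervalIntegrable _ _
    _ ≤ _ := by
        apply intervalIntegral.integral_mono_on hab
        · exact (continuous_const.mul (hwc.sub
            (continuous_const.mul (hvc.norm.pow 2)))).intervalIntegrable _ _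
        · have hcont : Continuous fun t =>
              F (γ t) - m * (‖u (γ t)‖ ^ 2 / ‖γ t - a‖ ^ 2) := by
            simp only [hnorm]
            exact (hFc.comp hγc).sub (continuous_const.mul ((hvc.norm.pow 2).div_const _))
          exact hcont.intervalIntegrable _ _
        · intro t _
          exact hpt t

/-- The Aharonov–Bohm (Hardy-type) inequality of Laptev–Weidl: for every `r > 0`,
every pole `a ∈ ℝ² ≅ ℂ`, every circulation `α ∈ ℝ`, and every smooth compactly
supported function `u` with support contained in `D_r(a) \ {a}`,
`∫_{D_r(a)} ‖(i∇ + A_a^α)u‖² ≥ (min_{j ∈ ℤ} |j − α|)² ∫_{D_r(a)} |u|²/‖x − a‖²`. -/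
theorem hardy_type_inequality
    (r : ℝ) (hr : 0 < r) (a : ℂ) (α : ℝ) (u : ℂ → ℂ)
    (hu : ContDiff ℝ (⊤ : ℕ∞) u) (hcs : HasCompactSupport u)
    (hsupp : tsupport u ⊆ Metric.ball a r \ {a}) :
    (⨅ j : ℤ, |(j : ℝ) - α|) ^ 2 *
        ∫ x in Metric.ball a r, ‖u x‖ ^ 2 / ‖x - a‖ ^ 2 ≤
      ∫ x in Metric.ball a r,
        (‖Complex.I * fderiv ℝ u x 1 +
            ((α * (-(x - a).im / ‖x - a‖ ^ 2) : ℝ) : ℂ) * u x‖ ^ 2 +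
         ‖Complex.I * fderiv ℝ u x Complex.I +
            ((α * ((x - a).re / ‖x - a‖ ^ 2) : ℝ) : ℂ) * u x‖ ^ 2) := by
  set F : ℂ → ℝ := fun x => (‖Complex.I * fderiv ℝ u x 1 +
            ((α * (-(x - a).im / ‖x - a‖ ^ 2) : ℝ) : ℂ) * u x‖ ^ 2 +
         ‖Complex.I * fderiv ℝ u x Complex.I +
            ((α * ((x - a).re / ‖x - a‖ ^ 2) : ℝ) : ℂ) * u x‖ ^ 2) with hF
  set g : ℂ → ℝ := fun x => ‖u x‖ ^ 2 / ‖x - a‖ ^ 2 with hg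
  set m := (⨅ j : ℤ, |(j : ℝ) - α|) ^ 2 with hm
  have ha : a ∉ tsupport u := fun h => (hsupp h).2 rfl
  have hu0 : ∀ x, x ∉ tsupport u → u x = 0 := fun x hx => image_eq_zero_of_notMem_tsupport hx
  have hdu0 : ∀ x, x ∉ tsupport u → fderiv ℝ u x = 0 := fun x hx =>
    image_eq_zero_of_notMem_tsupport fun h => hx (tsupport_fderiv_subset ℝ h)
  have hF0 : ∀ x, x ∉ tsupport u → F x = 0 := by
    intro x hx
    simp [hF, hu0 x hx, hdu0 x hx]
  have hg0 : ∀ x, x ∉ tsupport u → g x = 0 := by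
    intro x hx
    simp [hg, hu0 x hx]
  have hdu : Continuous (fderiv ℝ u) := hu.continuous_fderiv (by simp)
  have huc : Continuous u := hu.continuous
  have hnear : ∀ f : ℂ → ℝ, (∀ x, x ∉ tsupport u → f x = 0) → ContinuousAt f a := by
    intro f hf
    have : f =ᶠ[nhds a] fun _ => 0 := by
      filter_upwards [(isClosed_tsupport u).isOpen_compl.mem_nhds ha] with x hx
      exact hf x hx
    exact continuousAt_const.congr this.symm
  have hFc : Continuous F := by
    rw [continuous_iff_continuousAt]
    intro x
    rcases eq_or_ne x a with rfl | hx
    · exact hnear F hF0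
    · have h2 : ‖x - a‖ ^ 2 ≠ 0 := pow_ne_zero _ (norm_ne_zero_iff.2 (sub_ne_zero.2 hx))
      have hn : ContinuousAt (fun x : ℂ => ‖x - a‖ ^ 2) x := by fun_prop
      have hre : ContinuousAt (fun x : ℂ => (x - a).re / ‖x - a‖ ^ 2) x :=
        ContinuousAt.div (by fun_prop) hn h2
      have him : ContinuousAt (fun x : ℂ => -(x - a).im / ‖x - a‖ ^ 2) x :=
        ContinuousAt.div (by fun_prop) hn h2
      have hre' : ContinuousAt (fun x : ℂ => ((α * ((x - a).re / ‖x - a‖ ^ 2) : ℝ) : ℂ)) x :=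
        continuous_ofReal.continuousAt.comp (continuousAt_const.mul hre)
      have him' : ContinuousAt (fun x : ℂ => ((α * (-(x - a).im / ‖x - a‖ ^ 2) : ℝ) : ℂ)) x :=
        continuous_ofReal.continuousAt.comp (continuousAt_const.mul him)
      have hd1 : Continuous fun x => fderiv ℝ u x 1 := hdu.clm_apply continuous_const
      have hd2 : Continuous fun x => fderiv ℝ u x I := hdu.clm_apply continuous_const
      exact ((((continuousAt_const.mul hd1.continuousAt).add
        (him'.mul huc.continuousAt)).norm).pow 2).add
        ((((continuousAt_const.mul hd2.continuousAt).add
        (hre'.mul huc.continuousAt)).norm).pow 2)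
  have hgc : Continuous g := by
    rw [continuous_iff_continuousAt]
    intro x
    rcases eq_or_ne x a with rfl | hx
    · exact hnear g hg0
    · have h2 : ‖x - a‖ ^ 2 ≠ 0 := pow_ne_zero _ (norm_ne_zero_iff.2 (sub_ne_zero.2 hx))
      exact ContinuousAt.div (by fun_prop) (by fun_prop) h2
  have hFi : Integrable F := hFc.integrable_of_hasCompactSupport
    (HasCompactSupport.intro hcs hF0)
  have hgi : Integrable g := hgc.integrable_of_hasCompactSupport
    (HasCompactSupport.intro hcs hg0)
  have hball : ∀ x, x ∉ Metric.ball a r → x ∉ tsupport u := fun x hx h => hx (hsupp h).1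
  rw [setIntegral_eq_integral_of_forall_compl_eq_zero fun x hx => hg0 x (hball x hx),
    setIntegral_eq_integral_of_forall_compl_eq_zero fun x hx => hF0 x (hball x hx),
    ← sub_nonneg, ← integral_const_mul, ← integral_sub hFi (hgi.const_mul m),
    ← integral_add_right_eq_self _ a, ← Complex.integral_comp_polarCoord_symm, polarCoord_target]
  by_cases hint : IntegrableOn (fun p : ℝ × ℝ => p.1 • (F (Complex.polarCoord.symm p + a)
      - m * g (Complex.polarCoord.symm p + a))) (Set.Ioi 0 ×ˢ Set.Ioo (-Real.pi) Real.pi)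
      (volume.prod volume)
  · rw [Measure.volume_eq_prod, setIntegral_prod _ hint]
    apply setIntegral_nonneg measurableSet_Ioi
    intro ρ hρ
    simp only [smul_eq_mul, Complex.polarCoord_symm_apply]
    rw [integral_const_mul]
    exact mul_nonneg (le_of_lt hρ) (hti_radius a α u hu F hF hFc ρ hρ)
  · rw [Measure.volume_eq_prod, integral_undef hint]
end

section
/- Let λ ∈ ℝ and let φ : ℂ → ℂ be twice continuously differentiable on B(0,1) \ {0}, satisfy the K₀-reality condition (x/‖x‖)·conj(φ(x)) = φ(x) for all x ∈ B(0,1) \ {0}, and solve the Aharonov–Bohm eigenequation −Δφ(x) + 2i·Dφ(x)[A₀(x)] + ‖A₀(x)‖²·φ(x) = λ·φ(x) for all x ∈ B(0,1) \ {0}. Define ψ : B(0,1) \ {0} → ℂ by ψ(y) = (conj(y)/‖y‖)·φ(y²). Then: (i) ψ is real-valued, i.e. Im(ψ(y)) = 0 for all y ∈ B(0,1) \ {0}; and (ii) ψ is twice continuously differentiable on B(0,1) \ {0} and satisfies −Δψ(y) = 4λ·‖y‖²·ψ(y) for all y ∈ B(0,1) \ {0}. -/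
open Complex

/-- The pointwise Euclidean Laplacian on `ℝ² ≅ ℂ` of a complex-valued function,
as the sum of the second directional derivatives in the directions `1` and `I`. -/
noncomputable def lapC (f : ℂ → ℂ) (x : ℂ) : ℂ :=
  fderiv ℝ (fun y => fderiv ℝ f y 1) x 1 +
    fderiv ℝ (fun y => fderiv ℝ f y Complex.I) x Complex.I

/-- The Aharonov–Bohm potential with pole `0` and circulation `1/2`:
`A₀(x) = (1/2)·(−x₂, x₁)/‖x‖²`, written in complex notation as `(I·x)/(2‖x‖²)`. -/
noncomputable def A0 (x : ℂ) : ℂ := (Complex.I * x) / (2 * (‖x‖ : ℂ) ^ 2)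

lemma dc_line {f : ℂ → ℂ} {y v c : ℂ} (hf : DifferentiableAt ℝ f y)
    (h : HasDerivAt (fun t : ℝ => f (y + (t : ℂ) * v)) c 0) : fderiv ℝ f y v = c := by
  have hl := hf.hasFDerivAt.hasLineDerivAt v
  unfold HasLineDerivAt at hl
  have e : (fun t : ℝ => f (y + t • v)) = (fun t : ℝ => f (y + (t : ℂ) * v)) := by
    funext t; simp
  rw [e] at hl
  exact hl.unique h

lemma dc_hline (y v : ℂ) : HasDerivAt (fun t : ℝ => y + (t : ℂ) * v) v 0 := by
  have h : HasDerivAt (fun t : ℝ => (t : ℂ)) 1 0 := Complex.ofRealCLM.hasDerivAt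
  simpa using (h.mul_const v).const_add y

lemma dc_comp {f : ℂ → ℂ} {y v : ℂ} (hf : DifferentiableAt ℝ f y) :
    HasDerivAt (fun t : ℝ => f (y + (t : ℂ) * v)) (fderiv ℝ f y v) 0 := by
  have h1 : HasFDerivAt f (fderiv ℝ f y) (y + ((0 : ℝ) : ℂ) * v) := by
    simpa using hf.hasFDerivAt
  exact h1.comp_hasDerivAt (0 : ℝ) (dc_hline y v)

/-- The phase. -/
noncomputable def dcg (y : ℂ) : ℂ := (starRingEnd ℂ) y / (‖y‖ : ℂ)

lemma dcg_contDiffAt {y : ℂ} (hy : y ≠ 0) : ContDiffAt ℝ 2 dcg y := by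
  have h1 : ContDiffAt ℝ 2 (fun y : ℂ => (starRingEnd ℂ) y) y :=
    Complex.conjCLE.contDiff.contDiffAt
  have h2 : ContDiffAt ℝ 2 (fun y : ℂ => ((‖y‖ : ℝ) : ℂ)) y :=
    Complex.ofRealCLM.contDiff.contDiffAt.comp y (contDiffAt_norm ℝ hy)
  have h3 : ((‖y‖ : ℝ) : ℂ) ≠ 0 := by simpa using hy
  have h4 := h1.mul (h2.inv h3)
  exact h4

lemma dcg_ne {y : ℂ} (hy : y ≠ 0) : dcg y ≠ 0 := by
  unfold dcg
  exact div_ne_zero (by simpa using hy) (by simpa using hy)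

lemma dc_normsq (y : ℂ) : ((‖y‖ : ℝ) : ℂ) ^ 2 = y * (starRingEnd ℂ) y := by
  rw [Complex.mul_conj, Complex.normSq_eq_norm_sq]; push_cast; rfl

lemma dcg_sq {y : ℂ} (hy : y ≠ 0) : dcg y * dcg y * y = (starRingEnd ℂ) y := by
  have hn : ((‖y‖ : ℝ) : ℂ) ≠ 0 := by simpa using hy
  have := dc_normsq y
  unfold dcg
  field_simp
  rw [this]; ring

lemma dc_conj_line (y v : ℂ) :
    HasDerivAt (fun t : ℝ => (starRingEnd ℂ) (y + (t : ℂ) * v)) ((starRingEnd ℂ) v) 0 := by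
  have := (Complex.conjCLE : ℂ →L[ℝ] ℂ).hasFDerivAt.comp_hasDerivAt (0 : ℝ) (dc_hline y v)
  simpa [Function.comp_def] using this

lemma dcg_fderiv {y : ℂ} (hy : y ≠ 0) (v : ℂ) :
    fderiv ℝ dcg y v =
      dcg y * (((starRingEnd ℂ) v * ((starRingEnd ℂ) y)⁻¹ - v * y⁻¹) / 2) := by
  have hd : DifferentiableAt ℝ dcg y := (dcg_contDiffAt hy).differentiableAt (by norm_num)
  have hg := dc_comp (v := v) hd
  have h := ((hg.mul hg).mul (dc_hline y v)).unique ((dc_conj_line y v).congr_of_eventuallyEq ?_)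
  · simp only [Pi.mul_apply, ofReal_zero, zero_mul, add_zero] at h
    have hs := dcg_sq hy
    have hgne := dcg_ne hy
    have hc : (starRingEnd ℂ) y ≠ 0 := by simpa using hy
    rw [← h, ← hs]
    field_simp
    ring
  · have hc : ContinuousAt (fun t : ℝ => y + (t : ℂ) * v) 0 := (dc_hline y v).continuousAt
    have : ∀ᶠ t : ℝ in nhds 0, y + (t : ℂ) * v ≠ 0 := by
      apply hc.eventually_ne; simpa using hy
    filter_upwards [this] with t ht
    exact dcg_sq ht

lemma dc_lap_trace (B : ℂ →L[ℝ] ℂ →L[ℝ] ℂ) (a : ℂ) :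
    B a a + B (a * I) (a * I) = (a * (starRingEnd ℂ) a) * (B 1 1 + B I I) := by
  have h1 : a = a.re • (1 : ℂ) + a.im • I := by
    apply Complex.ext <;> simp
  have h2 : a * I = (-a.im) • (1 : ℂ) + a.re • I := by
    apply Complex.ext <;> simp
  rw [h2, Complex.mul_conj, Complex.normSq_apply]
  conv_lhs => enter [1]; rw [h1]
  simp only [map_add, map_smul, add_apply, smul_apply]
  simp only [Complex.real_smul]
  push_cast
  ring

/-- If `φ` is a `C²`, `K₀`-real solution of the Aharonov–Bohm eigenequation
`−Δφ + 2i·Dφ[A₀] + ‖A₀‖²φ = λφ` on the punctured unit disk, then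
`ψ(y) = (conj y/‖y‖)·φ(y²)` is real valued, `C²`, and satisfies `−Δψ = 4λ‖y‖²ψ`
on the punctured unit disk. -/
theorem eigenfunction_to_double_covering
    (lam : ℝ) (φ : ℂ → ℂ)
    (hreg : ContDiffOn ℝ 2 φ (Metric.ball (0 : ℂ) 1 \ {0}))
    (hK : ∀ x ∈ Metric.ball (0 : ℂ) 1 \ {0},
      (x / (‖x‖ : ℂ)) * (starRingEnd ℂ) (φ x) = φ x)
    (heq : ∀ x ∈ Metric.ball (0 : ℂ) 1 \ {0},
      -lapC φ x + 2 * Complex.I * fderiv ℝ φ x (A0 x)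
        + ((‖A0 x‖ ^ 2 : ℝ) : ℂ) * φ x = (lam : ℂ) * φ x)
    (ψ : ℂ → ℂ)
    (hψ : ∀ y, ψ y = ((starRingEnd ℂ) y / (‖y‖ : ℂ)) * φ (y ^ 2)) :
    (∀ y ∈ Metric.ball (0 : ℂ) 1 \ {0}, (ψ y).im = 0) ∧
    ContDiffOn ℝ 2 ψ (Metric.ball (0 : ℂ) 1 \ {0}) ∧
    ∀ y ∈ Metric.ball (0 : ℂ) 1 \ {0},
      -lapC ψ y = 4 * (lam : ℂ) * ((‖y‖ ^ 2 : ℝ) : ℂ) * ψ y := by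
  obtain rfl : ψ = fun y => dcg y * φ (y ^ 2) := by
    funext y; rw [hψ]; rfl
  clear hψ
  set U : Set ℂ := Metric.ball (0 : ℂ) 1 \ {0} with hU
  have hUo : IsOpen U := Metric.isOpen_ball.sdiff isClosed_singleton
  have hsq : ∀ y ∈ U, y ^ 2 ∈ U := by
    rintro y ⟨hy1, hy0⟩
    refine ⟨?_, ?_⟩
    · simp only [Metric.mem_ball, dist_zero_right, norm_pow] at hy1 ⊢
      nlinarith [norm_nonneg y]
    · simpa using hy0
  have hne : ∀ y ∈ U, y ≠ 0 := fun y hy => by simpa using hy.2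
  have hφ : ∀ x ∈ U, ContDiffAt ℝ 2 φ x := fun x hx => hreg.contDiffAt (hUo.mem_nhds hx)
  have hpsi : ∀ y ∈ U, ContDiffAt ℝ 2 (fun y => dcg y * φ (y ^ 2)) y := by
    intro y hy
    refine (dcg_contDiffAt (hne y hy)).mul ?_
    exact (hφ _ (hsq y hy)).comp y (contDiff_id.pow 2).contDiffAt
  refine ⟨?_, fun y hy => (hpsi y hy).contDiffWithinAt, ?_⟩
  · intro y hy
    have hk := hK _ (hsq y hy)
    have hy0 := hne y hy
    have hn : ((‖y‖ : ℝ) : ℂ) ≠ 0 := by simpa using hy0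
    rw [← Complex.conj_eq_iff_im]
    have h2 := dc_normsq y
    simp only [dcg, map_mul, map_div₀, Complex.conj_conj, Complex.conj_ofReal]
    conv_rhs => rw [← hk]
    simp only [norm_pow, map_mul, map_div₀, Complex.conj_conj, ofReal_pow, map_pow, Complex.conj_ofReal]
    field_simp
    rw [h2]
    ring
  · intro y hy
    -- the derivative of the square map along lines
    have hsqline : ∀ z v : ℂ, HasDerivAt (fun t : ℝ => (z + (t : ℂ) * v) ^ 2) (2 * z * v) 0 := by
      intro z v
      exact ((dc_hline z v).pow 2).congr_deriv (by simp)
    have hP : ∀ z ∈ U, ∀ v : ℂ, HasDerivAt (fun t : ℝ => φ ((z + (t : ℂ) * v) ^ 2))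
        (fderiv ℝ φ (z ^ 2) (2 * z * v)) 0 := by
      intro z hz v
      have hd : DifferentiableAt ℝ φ (z ^ 2) := (hφ _ (hsq z hz)).differentiableAt (by norm_num)
      have h1 : HasFDerivAt φ (fderiv ℝ φ (z ^ 2)) ((z + ((0 : ℝ) : ℂ) * v) ^ 2) := by
        simpa using hd.hasFDerivAt
      exact h1.comp_hasDerivAt (0 : ℝ) (hsqline z v)
    have hfirst : ∀ v : ℂ, ∀ z ∈ U, fderiv ℝ (fun y => dcg y * φ (y ^ 2)) z v =
        dcg z * (((starRingEnd ℂ) v * ((starRingEnd ℂ) z)⁻¹ - v * z⁻¹) / 2) * φ (z ^ 2)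
          + dcg z * fderiv ℝ φ (z ^ 2) (2 * z * v) := by
      intro v z hz
      apply dc_line ((hpsi z hz).differentiableAt (by norm_num))
      have hg := dc_comp (v := v) ((dcg_contDiffAt (hne z hz)).differentiableAt (by norm_num))
      have := hg.mul (hP z hz v)
      rw [dcg_fderiv (hne z hz)] at this
      exact this.congr_deriv (by simp)
    have hy0 := hne y hy
    have hcy0 : (starRingEnd ℂ) y ≠ 0 := by simpa using hy0
    have hB : ∀ x ∈ U, HasFDerivAt (fderiv ℝ φ) (fderiv ℝ (fderiv ℝ φ) x) x := by
      intro x hx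
      have h1 : ContDiffAt ℝ 1 (fderiv ℝ φ) x := (hφ x hx).fderiv_right (by norm_num)
      exact (h1.differentiableAt (by norm_num)).hasFDerivAt
    set B := fderiv ℝ (fderiv ℝ φ) (y ^ 2) with hBdef
    have hsecond : ∀ v : ℂ,
        fderiv ℝ (fun z => fderiv ℝ (fun y => dcg y * φ (y ^ 2)) z v) y v =
        dcg y * ((((starRingEnd ℂ) v * ((starRingEnd ℂ) y)⁻¹ - v * y⁻¹) / 2) ^ 2 * φ (y ^ 2)
          + (-(((starRingEnd ℂ) v) ^ 2 * (((starRingEnd ℂ) y)⁻¹) ^ 2) + v ^ 2 * (y⁻¹) ^ 2) / 2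
              * φ (y ^ 2)
          + ((starRingEnd ℂ) v * ((starRingEnd ℂ) y)⁻¹ - v * y⁻¹)
              * fderiv ℝ φ (y ^ 2) (2 * y * v)
          + B (2 * y * v) (2 * y * v) + fderiv ℝ φ (y ^ 2) (2 * v * v)) := by
      intro v
      have hdiff : DifferentiableAt ℝ
          (fun z => fderiv ℝ (fun y => dcg y * φ (y ^ 2)) z v) y := by
        have h1 : ContDiffAt ℝ 1 (fderiv ℝ (fun y => dcg y * φ (y ^ 2))) y :=
          (hpsi y hy).fderiv_right (by norm_num)
        exact (h1.differentiableAt (by norm_num)).clm_apply (differentiableAt_const v)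
      apply dc_line hdiff
      have hev : ∀ᶠ t : ℝ in nhds 0, y + (t : ℂ) * v ∈ U := by
        apply (dc_hline y v).continuousAt.eventually_mem
        simpa using hUo.mem_nhds hy
      have hg := dc_comp (v := v) ((dcg_contDiffAt hy0).differentiableAt (by norm_num))
      rw [dcg_fderiv hy0] at hg
      have hl := dc_hline y v
      have hi := hl.inv (by simpa using hy0)
      have hci := (dc_conj_line y v).inv (by simpa using hy0)
      have hD : HasDerivAt (fun t : ℝ => fderiv ℝ φ ((y + (t : ℂ) * v) ^ 2))
          (B (2 * y * v)) 0 := by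
        have h1 : HasFDerivAt (fderiv ℝ φ) B ((y + ((0 : ℝ) : ℂ) * v) ^ 2) := by
          simpa using hB _ (hsq y hy)
        exact h1.comp_hasDerivAt (0 : ℝ) (hsqline y v)
      have hDa := hD.clm_apply ((hl.const_mul 2).mul_const v)
      have htot := ((hg.mul (((hci.const_mul ((starRingEnd ℂ) v)).sub
        (hi.const_mul v)).div_const 2)).mul (hP y hy v)).add (hg.mul hDa)
      refine (htot.congr_of_eventuallyEq ?_).congr_deriv ?_
      · filter_upwards [hev] with t ht
        rw [hfirst v _ ht]
        rfl
      · simp only [Pi.mul_apply, Pi.sub_apply, Pi.inv_apply, ofReal_zero, zero_mul, add_zero]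
        field_simp
        ring
    have hlapφ : lapC φ (y ^ 2) = B 1 1 + B I I := by
      unfold lapC
      have h1 : ∀ v : ℂ, fderiv ℝ (fun y => fderiv ℝ φ y v) (y ^ 2) v = B v v := by
        intro v
        have := ((hB _ (hsq y hy)).clm_apply (hasFDerivAt_const v (y ^ 2))).fderiv
        rw [this]; simp [B]
      rw [h1, h1]
    have heq' := heq _ (hsq y hy)
    have hnn := dc_normsq y
    have hA : A0 (y ^ 2) = ((1 / (2 * ‖y‖ ^ 4) : ℝ)) • (I * y ^ 2) := by
      unfold A0
      rw [Complex.real_smul, norm_pow]; push_cast; ring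
    have hny : ‖y‖ ≠ 0 := by simpa using hy0
    have hnC : ((‖y‖ : ℝ) : ℂ) ≠ 0 := by simpa using hy0
    have hAn : ‖A0 (y ^ 2)‖ ^ 2 = 1 / (4 * ‖y‖ ^ 4) := by
      rw [hA, norm_smul]
      simp
      field_simp
      norm_num
    rw [hAn, hA, map_smul, hlapφ, Complex.real_smul] at heq'
    have htr := dc_lap_trace B (2 * y)
    have hD2 : fderiv ℝ φ (y ^ 2) (2 * I * I) = - fderiv ℝ φ (y ^ 2) (2 * 1 * 1) := by
      rw [← map_neg]; congr 1; linear_combination 2 * I_mul_I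
    -- gradient cross term
    have hcross : ((starRingEnd ℂ) y)⁻¹ * (fderiv ℝ φ (y ^ 2) (2 * y * 1)
          - I * fderiv ℝ φ (y ^ 2) (2 * y * I))
        - y⁻¹ * (fderiv ℝ φ (y ^ 2) (2 * y * 1) + I * fderiv ℝ φ (y ^ 2) (2 * y * I))
        = -4 * I * (1 / (‖y‖ : ℂ) ^ 2) * fderiv ℝ φ (y ^ 2) (I * y ^ 2) := by
      have hdec : I * y ^ 2 = (-y.im / 2) • (2 * y * 1) + (y.re / 2) • (2 * y * I) := by
        simp only [Complex.real_smul]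
        push_cast
        conv_lhs => rw [pow_two]; enter [2, 1]; rw [← Complex.re_add_im y]
        linear_combination y.im * y * I_mul_I
      rw [hdec, map_add, map_smul, map_smul, hnn]
      simp only [Complex.real_smul]
      generalize fderiv ℝ φ (y ^ 2) (2 * y * 1) = p
      generalize fderiv ℝ φ (y ^ 2) (2 * y * I) = q
      have e1 : y = y.re + y.im * I := (Complex.re_add_im y).symm
      have e2 : (starRingEnd ℂ) y = y.re - y.im * I := by
        apply Complex.ext <;> simp
      have h3 : ((y.re : ℝ) : ℂ) = (y + (starRingEnd ℂ) y) / 2 := by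
        rw [e2]; linear_combination (-1 / 2) * e1
      have h4 : ((y.im : ℝ) : ℂ) = -I * (y - (starRingEnd ℂ) y) / 2 := by
        rw [e2]; linear_combination (I / 2) * e1 + y.im * I_mul_I
      push_cast
      rw [h3, h4]
      field_simp
      linear_combination (4 * p * (y - (starRingEnd ℂ) y)) * I_mul_I
    unfold lapC
    rw [hsecond, hsecond]
    have htr' : B (2 * y * 1) (2 * y * 1) + B (2 * y * I) (2 * y * I)
        = 4 * (‖y‖ : ℂ) ^ 2 * (B 1 1 + B I I) := by
      rw [hnn, mul_one, htr]
      simp only [map_mul, map_ofNat]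
      ring
    have hab : ((starRingEnd ℂ) y)⁻¹ * y⁻¹ = 1 / (‖y‖ : ℂ) ^ 2 := by
      rw [hnn]; field_simp
    simp only [map_one, conj_I]
    rw [hD2]
    push_cast at heq' ⊢
    have hm : (‖y‖ : ℂ) ^ 2 * (1 / (‖y‖ : ℂ) ^ 2) = 1 := by field_simp
    have hm4 : (1 : ℂ) / (2 * (‖y‖ : ℂ) ^ 4) = (1 / (‖y‖ : ℂ) ^ 2) ^ 2 / 2 := by field_simp
    have hm4' : (1 : ℂ) / (4 * (‖y‖ : ℂ) ^ 4) = (1 / (‖y‖ : ℂ) ^ 2) ^ 2 / 4 := by field_simp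
    rw [hm4, hm4'] at heq'
    generalize (1 : ℂ) / (‖y‖ : ℂ) ^ 2 = m at *
    generalize (‖y‖ : ℂ) ^ 2 = N at *
    generalize ((starRingEnd ℂ) y)⁻¹ = a at *
    generalize y⁻¹ = b at *
    generalize fderiv ℝ φ (y ^ 2) (2 * y * 1) = p at *
    generalize fderiv ℝ φ (y ^ 2) (2 * y * I) = q at *
    generalize fderiv ℝ φ (y ^ 2) (2 * 1 * 1) = r at *
    generalize fderiv ℝ φ (y ^ 2) (I * y ^ 2) = D at *
    generalize B (2 * y * 1) (2 * y * 1) = B1 at *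
    generalize B (2 * y * I) (2 * y * I) = B2 at *
    generalize B 1 1 + B I I = L at *
    generalize dcg y = g at *
    generalize φ (y ^ 2) = f at *
    have hI : I ^ 2 = -1 := I_sq
    linear_combination (-g) * hcross - g * htr' + 4 * N * g * heq'
      + (-(4 * I * m * D * g) - m * f * g) * hm + g * f * hab
      + (-g * f * ((a + b) ^ 2 / 4 + (-a ^ 2 + b ^ 2) / 2)) * hI
end

section
/- Let a ∈ ℝ² ≅ ℂ, let U ⊆ ℂ \ {a} be open, and let u : ℂ → ℂ be twice continuously differentiable on U. Define the pointwise Aharonov–Bohm operator L u = −Δu + 2i·Du[A_a] + ‖A_a‖²·u and the antilinear operator (K_a u)(x) = ((x−a)/‖x−a‖)·conj(u(x)). Then K_a u is twice continuously differentiable on U and L(K_a u)(x) = ((x−a)/‖x−a‖)·conj((L u)(x)) for every x ∈ U; i.e., L and K_a commute on U. -/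
open Complex

/-- The Aharonov–Bohm potential with pole `a` and circulation `1/2`:
`A_a(x) = (1/2)·(−(x₂−a₂), x₁−a₁)/‖x−a‖²`, in complex notation `I(x−a)/(2‖x−a‖²)`. -/
noncomputable def Apot (a x : ℂ) : ℂ := (Complex.I * (x - a)) / (2 * (‖x - a‖ : ℂ) ^ 2)

/-- The pointwise Aharonov–Bohm operator `L u = −Δu + 2i·Du[A_a] + ‖A_a‖²·u`. -/
noncomputable def abOp (a : ℂ) (u : ℂ → ℂ) (x : ℂ) : ℂ :=
  -lapC u x + 2 * Complex.I * fderiv ℝ u x (Apot a x) + ((‖Apot a x‖ ^ 2 : ℝ) : ℂ) * u x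

/-- The antilinear operator `(K_a u)(x) = ((x−a)/‖x−a‖)·conj(u(x))`. -/
noncomputable def Kop (a : ℂ) (u : ℂ → ℂ) (x : ℂ) : ℂ :=
  ((x - a) / (‖x - a‖ : ℂ)) * (starRingEnd ℂ) (u x)

open scoped ComplexConjugate Topology

/-- the phase -/
noncomputable def ph (a x : ℂ) : ℂ := (x - a) / (‖x - a‖ : ℂ)

/-- the logarithmic derivative of the phase in direction `v` -/
noncomputable def lg (a v x : ℂ) : ℂ := (v / (x - a) - conj v / conj (x - a)) / 2

lemma conj_sub_ne {a x : ℂ} (h : x ≠ a) : conj (x - a) ≠ 0 := by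
  exact (map_ne_zero (starRingEnd ℂ)).2 (sub_ne_zero.2 h)

lemma ph_contDiffAt {a x : ℂ} (h : x ≠ a) : ContDiffAt ℝ 2 (ph a) x := by
  have hz : x - a ≠ 0 := sub_ne_zero.2 h
  have h1 : ContDiffAt ℝ 2 (fun y : ℂ => y - a) x := by fun_prop
  have h2 : ContDiffAt ℝ 2 (fun y : ℂ => ((‖y - a‖ : ℝ) : ℂ)) x :=
    Complex.ofRealCLM.contDiff.contDiffAt.comp x (h1.norm ℝ hz)
  have h3 := h1.mul (h2.inv (by simpa using hz))
  have e : ph a = fun y : ℂ => (y - a) * ((‖y - a‖ : ℝ) : ℂ)⁻¹ := by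
    ext y; simp only [ph, div_eq_mul_inv]
  rw [e]
  exact h3

lemma ph_ne {a x : ℂ} (h : x ≠ a) : ph a x ≠ 0 := by
  have hz : x - a ≠ 0 := sub_ne_zero.2 h
  unfold ph
  exact div_ne_zero hz (by simpa using hz)

lemma ph_sq {a x : ℂ} (h : x ≠ a) : ph a x * ph a x = (x - a) * (conj (x - a))⁻¹ := by
  have hz : x - a ≠ 0 := sub_ne_zero.2 h
  have hc := conj_sub_ne h
  have hn : (‖x - a‖ : ℂ) ≠ 0 := by simpa using hz
  have := Complex.mul_conj' (x - a)
  unfold ph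
  field_simp
  rw [← this]

lemma hasFDerivAt_inv_sub {a x : ℂ} (h : x ≠ a) (v : ℂ) :
    DifferentiableAt ℝ (fun y : ℂ => (y - a)⁻¹) x ∧
    fderiv ℝ (fun y : ℂ => (y - a)⁻¹) x v = - v / (x - a) ^ 2 := by
  have hz : x - a ≠ 0 := sub_ne_zero.2 h
  have h1 : HasDerivAt (fun y : ℂ => (y - a)⁻¹) (-1 / (x - a) ^ 2) x :=
    ((hasDerivAt_id x).sub_const a).inv hz
  have h2 := h1.hasFDerivAt.restrictScalars ℝ
  refine ⟨h2.differentiableAt, ?_⟩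
  rw [h2.fderiv]
  simp; ring

lemma hasFDerivAt_inv_conj {a x : ℂ} (h : x ≠ a) (v : ℂ) :
    DifferentiableAt ℝ (fun y : ℂ => (conj (y - a))⁻¹) x ∧
    fderiv ℝ (fun y : ℂ => (conj (y - a))⁻¹) x v = - conj v / (conj (x - a)) ^ 2 := by
  obtain ⟨h1, h2⟩ := hasFDerivAt_inv_sub h v
  have h3 := (Complex.conjCLE : ℂ →L[ℝ] ℂ).hasFDerivAt.comp x h1.hasFDerivAt
  have e : (fun y : ℂ => (conj (y - a))⁻¹) =
      (Complex.conjCLE : ℂ →L[ℝ] ℂ) ∘ (fun y : ℂ => (y - a)⁻¹) := by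
    ext y; simp
  rw [e]
  refine ⟨h3.differentiableAt, ?_⟩
  rw [h3.fderiv, ContinuousLinearMap.comp_apply, h2]
  simp

lemma fderiv_ph {a x : ℂ} (h : x ≠ a) (v : ℂ) :
    fderiv ℝ (ph a) x v = ph a x * lg a v x := by
  have hz : x - a ≠ 0 := sub_ne_zero.2 h
  have hc := conj_sub_ne h
  have hd : DifferentiableAt ℝ (ph a) x := (ph_contDiffAt h).differentiableAt (by norm_num)
  have hE : (fun y => ph a y * ph a y) =ᶠ[𝓝 x] fun y => (y - a) * (conj (y - a))⁻¹ := by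
    filter_upwards [isOpen_ne.mem_nhds h] with y hy using ph_sq hy
  obtain ⟨h1, h2⟩ := hasFDerivAt_inv_conj h v
  have h0 : HasFDerivAt (fun y : ℂ => y - a) (ContinuousLinearMap.id ℝ ℂ) x :=
    (hasFDerivAt_id x).sub_const a
  have hF := congrArg (fun L : ℂ →L[ℝ] ℂ => L v) hE.fderiv_eq
  simp only [(hd.hasFDerivAt.fun_mul hd.hasFDerivAt).fderiv,
    (h0.fun_mul h1.hasFDerivAt).fderiv, add_apply, smul_apply, smul_eq_mul,
    ContinuousLinearMap.id_apply, h2] at hF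
  have hp := ph_ne h
  have hs := ph_sq h
  apply mul_left_cancel₀ (mul_ne_zero two_ne_zero hp)
  have : 2 * ph a x * (ph a x * lg a v x) = 2 * (ph a x * ph a x) * lg a v x := by ring
  rw [this, hs, lg]
  have e : 2 * ph a x * fderiv ℝ (ph a) x v =
    ph a x * fderiv ℝ (ph a) x v + ph a x * fderiv ℝ (ph a) x v := by ring
  rw [e, hF]
  field_simp
  ring

lemma fderiv_lg {a x : ℂ} (h : x ≠ a) (v : ℂ) :
    DifferentiableAt ℝ (lg a v) x ∧
    fderiv ℝ (lg a v) x v = (-v ^ 2 / (x - a) ^ 2 + (conj v) ^ 2 / (conj (x - a)) ^ 2) / 2 := by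
  obtain ⟨h1, h2⟩ := hasFDerivAt_inv_conj h v
  obtain ⟨h3, h4⟩ := hasFDerivAt_inv_sub h v
  have hh := ((h3.hasFDerivAt.const_mul v).fun_sub (h1.hasFDerivAt.const_mul (conj v))).mul_const
    ((2 : ℂ)⁻¹)
  have e : lg a v = fun y => (v * (y - a)⁻¹ - conj v * (conj (y - a))⁻¹) * (2 : ℂ)⁻¹ := by
    ext y; simp only [lg, div_eq_mul_inv]
  rw [e]
  refine ⟨hh.differentiableAt, ?_⟩
  rw [hh.fderiv]
  simp only [sub_apply, smul_apply, smul_eq_mul, h2, h4]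
  ring

lemma hasFDerivAt_conj_comp {f : ℂ → ℂ} {x : ℂ} (hf : DifferentiableAt ℝ f x) :
    DifferentiableAt ℝ (fun y => conj (f y)) x ∧
    ∀ v, fderiv ℝ (fun y => conj (f y)) x v = conj (fderiv ℝ f x v) := by
  have h3 : HasFDerivAt (fun y => conj (f y)) _ x :=
    (Complex.conjCLE : ℂ →L[ℝ] ℂ).hasFDerivAt.comp x hf.hasFDerivAt
  refine ⟨h3.differentiableAt, fun v => ?_⟩
  rw [h3.fderiv]
  simp

lemma fderiv_Kop {a x : ℂ} (h : x ≠ a) {u : ℂ → ℂ} (hu : DifferentiableAt ℝ u x) (v : ℂ) :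
    fderiv ℝ (Kop a u) x v = ph a x * (lg a v x * conj (u x) + conj (fderiv ℝ u x v)) := by
  have hd : DifferentiableAt ℝ (ph a) x := (ph_contDiffAt h).differentiableAt (by norm_num)
  obtain ⟨h1, h2⟩ := hasFDerivAt_conj_comp hu
  have hm : HasFDerivAt (Kop a u) _ x := hd.hasFDerivAt.fun_mul h1.hasFDerivAt
  rw [hm.fderiv]
  simp only [add_apply, smul_apply, smul_eq_mul, h2, fderiv_ph h]
  ring

lemma fderiv2_Kop {a x : ℂ} (h : x ≠ a) {u : ℂ → ℂ} (hu : ContDiffAt ℝ 2 u x) (v : ℂ) :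
    fderiv ℝ (fun y => fderiv ℝ (Kop a u) y v) x v =
      ph a x * (lg a v x * (lg a v x * conj (u x) + conj (fderiv ℝ u x v)) +
        (fderiv ℝ (lg a v) x v * conj (u x) + lg a v x * conj (fderiv ℝ u x v)
          + conj (fderiv ℝ (fun y => fderiv ℝ u y v) x v))) := by
  have hE : (fun y => fderiv ℝ (Kop a u) y v) =ᶠ[𝓝 x]
      fun y => ph a y * (lg a v y * conj (u y) + conj (fderiv ℝ u y v)) := by
    filter_upwards [isOpen_ne.mem_nhds h, hu.eventually (by simp)] with y hy hy2
    exact fderiv_Kop hy (hy2.differentiableAt (by norm_num)) v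
  rw [hE.fderiv_eq]
  have hd : DifferentiableAt ℝ (ph a) x := (ph_contDiffAt h).differentiableAt (by norm_num)
  obtain ⟨h1, h2⟩ := hasFDerivAt_conj_comp (hu.differentiableAt (by norm_num))
  have hu' : DifferentiableAt ℝ (fun y => fderiv ℝ u y v) x :=
    (((hu.fderiv_right (m := 1) (by norm_num)).differentiableAt (by norm_num))).clm_apply
      (differentiableAt_const v)
  obtain ⟨h3, h4⟩ := hasFDerivAt_conj_comp hu'
  obtain ⟨h5, h6⟩ := fderiv_lg h v
  have hm := hd.hasFDerivAt.fun_mul ((h5.hasFDerivAt.fun_mul h1.hasFDerivAt).fun_add h3.hasFDerivAt)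
  rw [hm.fderiv]
  simp only [add_apply, smul_apply, smul_eq_mul, h2, h4, fderiv_ph h]
  ring

lemma Apot_eq {a x : ℂ} (h : x ≠ a) : Apot a x = I / (2 * conj (x - a)) := by
  have hz : x - a ≠ 0 := sub_ne_zero.2 h
  have hc := conj_sub_ne h
  rw [Apot, ← Complex.mul_conj']
  field_simp

lemma clm_decomp (L : ℂ →L[ℝ] ℂ) (w : ℂ) :
    L w = (w + conj w) / 2 * L 1 + (w - conj w) / (2 * I) * L I := by
  have e : w = w.re • (1 : ℂ) + w.im • I := by
    simp [Complex.re_add_im]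
  have h1 : (w + conj w) / 2 = (w.re : ℂ) := by rw [Complex.add_conj]; push_cast; ring
  have h2 : (w - conj w) / (2 * I) = (w.im : ℂ) := by
    rw [Complex.sub_conj]; push_cast; field_simp
  rw [h1, h2]
  conv_lhs => rw [e]
  rw [map_add, map_smul, map_smul]
  simp

/-- The Aharonov–Bohm operator `L` commutes with the antilinear operator `K_a`:
if `u` is `C²` on an open set `U ⊆ ℂ \ {a}`, then so is `K_a u`, and
`L(K_a u)(x) = ((x−a)/‖x−a‖)·conj((L u)(x))` on `U`. -/
theorem abOp_commutes_with_K
    (a : ℂ) (U : Set ℂ) (hU : IsOpen U) (hUa : a ∉ U)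
    (u : ℂ → ℂ) (hu : ContDiffOn ℝ 2 u U) :
    ContDiffOn ℝ 2 (Kop a u) U ∧
    ∀ x ∈ U, abOp a (Kop a u) x = ((x - a) / (‖x - a‖ : ℂ)) * (starRingEnd ℂ) (abOp a u x) := by
  have hne : ∀ x ∈ U, x ≠ a := fun x hx e => hUa (e ▸ hx)
  refine ⟨fun x hx => ?_, fun x hx => ?_⟩
  · have h1 := hu.contDiffAt (hU.mem_nhds hx)
    have h2 : ContDiffAt ℝ 2 (fun y => conj (u y)) x :=
      (Complex.conjCLE : ℂ →L[ℝ] ℂ).contDiff.contDiffAt.comp x h1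
    exact ((ph_contDiffAt (hne x hx)).mul h2).contDiffWithinAt
  · have h := hne x hx
    have hux := hu.contDiffAt (hU.mem_nhds hx)
    have hz : x - a ≠ 0 := sub_ne_zero.2 h
    have hc := conj_sub_ne h
    have hA : ((‖Apot a x‖ ^ 2 : ℝ) : ℂ) = 1 / (4 * (x - a) * conj (x - a)) := by
      push_cast
      rw [← Complex.mul_conj', Apot_eq h]
      simp only [map_div₀, map_mul, Complex.conj_I, Complex.conj_conj, map_ofNat]
      field_simp
      simp
      norm_num
    have hA' : conj (Apot a x) = - I / (2 * (x - a)) := by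
      rw [Apot_eq h]
      simp only [map_div₀, map_mul, Complex.conj_I, Complex.conj_conj, map_ofNat]
    have hK : Kop a u x = ph a x * conj (u x) := rfl
    change _ = ph a x * _
    unfold abOp lapC
    rw [clm_decomp (fderiv ℝ (Kop a u) x), clm_decomp (fderiv ℝ u x), fderiv2_Kop h hux,
      fderiv2_Kop h hux, (fderiv_lg h 1).2, (fderiv_lg h I).2,
      fderiv_Kop h (hux.differentiableAt (by norm_num)),
      fderiv_Kop h (hux.differentiableAt (by norm_num)), hA, hA', Apot_eq h, hK]
    generalize fderiv ℝ (fun y => fderiv ℝ u y 1) x 1 = p2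
    generalize fderiv ℝ (fun y => fderiv ℝ u y I) x I = q2
    generalize fderiv ℝ u x 1 = p
    generalize fderiv ℝ u x I = q
    generalize ph a x = e
    simp only [lg, map_add, map_neg, map_mul, map_div₀, map_sub, Complex.conj_I, map_one, map_ofNat,
      Complex.conj_conj]
    simp only [← map_sub]
    generalize conj (x - a) = zb at *
    generalize x - a = z at *
    have hI : I ^ 2 = -1 := Complex.I_sq
    have hI0 := Complex.I_ne_zero
    generalize I = i at *
    field_simp
    grind
end
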